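/- Assume (A1), (A2) and the normalization ψ(ξ) = 1 for |ξ| = 1. Then for every R > 0, sup_{0<δ<R} inf_{s≥1} [ h(2δ/ψ^{-1}(1/s)) / h(R/(2ψ^{-1}(1/s))) ] = +∞. (Equivalently, with h^s(r) = ∫_{ℝ^d} (|z|²/r² ∧ 1) ν^s(z) dz and ν^s(z) = s·ψ^{-1}(1/s)^{-d}·ν(z/ψ^{-1}(1/s)): sup_{0<δ<R} inf_{s≥1} h^s(2δ)/h^s(R/2) = +∞.) -/

import Mathlib

open MeasureTheory Filter Real
open scoped RealInnerProductSpace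

noncomputable section

/-- Pruitt's concentration function `K(r) = r⁻² ∫_{|z|<r} |z|² ν(|z|) dz`. -/
def K (d : ℕ) (ν : ℝ → ℝ) (r : ℝ) : ℝ :=
  (∫ z in Metric.ball (0 : EuclideanSpace ℝ (Fin d)) r, ‖z‖ ^ 2 * ν ‖z‖) / r ^ 2

/-- Pruitt's concentration function `h(r) = ∫ (|z|²/r² ∧ 1) ν(|z|) dz`. -/
def hfun (d : ℕ) (ν : ℝ → ℝ) (r : ℝ) : ℝ :=
  ∫ z : EuclideanSpace ℝ (Fin d), min (‖z‖ ^ 2 / r ^ 2) 1 * ν ‖z‖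

/-- The characteristic (Lévy–Khintchine) exponent `ψ(ξ) = ∫ (1 - cos⟪ξ,z⟫) ν(|z|) dz`. -/
def ψ (d : ℕ) (ν : ℝ → ℝ) (ξ : EuclideanSpace ℝ (Fin d)) : ℝ :=
  ∫ z : EuclideanSpace ℝ (Fin d), (1 - Real.cos ⟪ξ, z⟫) * ν ‖z‖

/-- The radial nondecreasing majorant `ψ*(r) = sup_{|z| ≤ r} ψ(z)`. -/
def ψstar (d : ℕ) (ν : ℝ → ℝ) (r : ℝ) : ℝ :=
  sSup {y : ℝ | ∃ z : EuclideanSpace ℝ (Fin d), ‖z‖ ≤ r ∧ ψ d ν z = y}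

/-- The generalized inverse `ψ⁻¹(u) = sup {r ≥ 0 : ψ*(r) = u}`. -/
def ψinv (d : ℕ) (ν : ℝ → ℝ) (u : ℝ) : ℝ :=
  sSup {r : ℝ | 0 ≤ r ∧ ψstar d ν r = u}

/-- Characteristic exponent `ψˢ(ξ) = s·ψ(ψ⁻¹(1/s)ξ)` of the rescaled process. -/
def ψs (d : ℕ) (ν : ℝ → ℝ) (s : ℝ) (ξ : EuclideanSpace ℝ (Fin d)) : ℝ :=
  s * ψ d ν (ψinv d ν (1 / s) • ξ)

/-- Lévy density `νˢ(x) = s·ψ⁻¹(1/s)^{-d}·ν(x/ψ⁻¹(1/s))` of the rescaled process. -/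
def νs (d : ℕ) (ν : ℝ → ℝ) (s : ℝ) (x : EuclideanSpace ℝ (Fin d)) : ℝ :=
  s / ψinv d ν (1 / s) ^ d * ν (‖x‖ / ψinv d ν (1 / s))

/-- `ψ^{-1,s}(u) = ψ⁻¹(u/s)/ψ⁻¹(1/s)`. -/
def ψinvs (d : ℕ) (ν : ℝ → ℝ) (s u : ℝ) : ℝ :=
  ψinv d ν (u / s) / ψinv d ν (1 / s)

/-- The stable constant `𝒜(d,α)`. -/
def Aconst (d : ℕ) (α : ℝ) : ℝ :=
  α * (2 : ℝ) ^ (α - 1) * Real.Gamma (((d : ℝ) + α) / 2) /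
    (Real.Gamma (1 - α / 2) * Real.pi ^ ((d : ℝ) / 2))

/-- Heat kernel of the rescaled process, via Fourier inversion. -/
def pts (d : ℕ) (ν : ℝ → ℝ) (s t : ℝ) (x : EuclideanSpace ℝ (Fin d)) : ℝ :=
  ((2 * Real.pi) ^ d)⁻¹ *
    ∫ ξ : EuclideanSpace ℝ (Fin d), Real.cos ⟪ξ, x⟫ * Real.exp (-(t * ψs d ν s ξ))

/-- Heat kernel of the isotropic α-stable process. -/
def ptα (d : ℕ) (α t : ℝ) (x : EuclideanSpace ℝ (Fin d)) : ℝ :=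
  ((2 * Real.pi) ^ d)⁻¹ *
    ∫ ξ : EuclideanSpace ℝ (Fin d), Real.cos ⟪ξ, x⟫ * Real.exp (-(t * ‖ξ‖ ^ α))

/-- Heat kernel of the original process, via Fourier inversion. -/
def pt (d : ℕ) (ν : ℝ → ℝ) (t : ℝ) (x : EuclideanSpace ℝ (Fin d)) : ℝ :=
  ((2 * Real.pi) ^ d)⁻¹ *
    ∫ ξ : EuclideanSpace ℝ (Fin d), Real.cos ⟪ξ, x⟫ * Real.exp (-(t * ψ d ν ξ))

section Auxiliary

variable {d : ℕ} {ν : ℝ → ℝ}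

lemma abs_one_sub_cos_inner_le (ξ z : EuclideanSpace ℝ (Fin d)) :
    |1 - cos ⟪ξ, z⟫| ≤ (2 + ‖ξ‖ ^ 2) * min (‖z‖ ^ 2) 1 := by
  rw [abs_of_nonneg (by linarith [cos_le_one ⟪ξ, z⟫])]
  rcases le_total (‖z‖ ^ 2) 1 with h | h
  · rw [min_eq_left h]
    have h1 := one_sub_sq_div_two_le_cos (x := ⟪ξ, z⟫)
    have h2 : ⟪ξ, z⟫ ^ 2 ≤ (‖ξ‖ * ‖z‖) ^ 2 := by
      rw [← sq_abs]
      gcongr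
      exact abs_real_inner_le_norm _ _
    rw [mul_pow] at h2
    nlinarith [sq_nonneg ‖z‖, sq_nonneg ‖ξ‖, mul_nonneg (sq_nonneg ‖ξ‖) (sq_nonneg ‖z‖)]
  · rw [min_eq_right h]
    linarith [neg_one_le_cos ⟪ξ, z⟫, sq_nonneg ‖ξ‖]

lemma ψ_le_ψstar (hψ : Continuous (ψ d ν)) {r : ℝ} {ξ : EuclideanSpace ℝ (Fin d)}
    (hξ : ‖ξ‖ ≤ r) : ψ d ν ξ ≤ ψstar d ν r := by
  refine le_csSup ?_ ⟨ξ, hξ, rfl⟩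
  refine ((isCompact_closedBall (0 : EuclideanSpace ℝ (Fin d)) r).bddAbove_image
    hψ.continuousOn).mono ?_
  rintro _ ⟨z, hz, rfl⟩
  exact ⟨z, by simpa using hz, rfl⟩

lemma min_sq_div_le {r : ℝ} (hr : 0 < r) (t : ℝ) :
    min (t ^ 2 / r ^ 2) 1 ≤ (1 + 1 / r ^ 2) * min (t ^ 2) 1 := by
  have h1 : 0 ≤ 1 / r ^ 2 := by positivity
  rcases le_total (t ^ 2) 1 with h | h
  · rw [min_eq_left h]
    calc min (t ^ 2 / r ^ 2) 1 ≤ t ^ 2 / r ^ 2 := min_le_left _ _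
      _ = 1 / r ^ 2 * t ^ 2 := by ring
      _ ≤ _ := by nlinarith [sq_nonneg t]
  · rw [min_eq_right h]
    exact (min_le_right _ _).trans (by linarith)

lemma min_sq_div_nonneg (r t : ℝ) : 0 ≤ min (t ^ 2 / r ^ 2) 1 :=
  le_min (by positivity) zero_le_one

lemma min_sq_div_mul_nonneg (hν_pos : ∀ r : ℝ, 0 < r → 0 < ν r)
    (r : ℝ) {t : ℝ} (ht : 0 ≤ t) : 0 ≤ min (t ^ 2 / r ^ 2) 1 * ν t := by
  rcases ht.eq_or_lt with rfl | ht
  · simp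
  · exact mul_nonneg (min_sq_div_nonneg r _) (hν_pos _ ht).le

lemma exists_ψstar_eq (hψ : Continuous (ψ d ν)) {u : ℝ} (hu : 0 < u)
    (hex : ∃ ξ : EuclideanSpace ℝ (Fin d), u ≤ ψ d ν ξ) :
    ∃ r : ℝ, 0 < r ∧ ψstar d ν r = u := by
  have hcl : IsClosed {ξ : EuclideanSpace ℝ (Fin d) | u ≤ ψ d ν ξ} :=
    isClosed_le continuous_const hψ
  obtain ⟨z₀, hz₀, hdist⟩ := hcl.exists_infDist_eq_dist hex 0
  have hmin (z : EuclideanSpace ℝ (Fin d)) (hz : u ≤ ψ d ν z) : ‖z₀‖ ≤ ‖z‖ := by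
    have := Metric.infDist_le_dist_of_mem (x := (0 : EuclideanSpace ℝ (Fin d)))
      (s := {ξ | u ≤ ψ d ν ξ}) hz
    rwa [hdist, dist_zero_left, dist_zero_left] at this
  have hψ0 : ψ d ν 0 = 0 := by simp [ψ]
  have hle (z : EuclideanSpace ℝ (Fin d)) (hz : ‖z‖ ≤ ‖z₀‖) : ψ d ν z ≤ u := by
    by_contra! hlt
    obtain ⟨t, ht, htu⟩ := intermediate_value_Icc zero_le_one
      (f := fun t : ℝ => ψ d ν (t • z)) (by fun_prop)
      (show u ∈ Set.Icc _ _ by simp [hψ0, hu.le, hlt.le])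
    dsimp only at htu
    have h1 := hmin _ htu.ge
    rw [norm_smul, norm_of_nonneg ht.1] at h1
    have hz0 : 0 < ‖z‖ := norm_pos_iff.2 fun h => by rw [h, hψ0] at hlt; linarith
    have ht1 : t = 1 := le_antisymm ht.2 (by nlinarith)
    rw [ht1, one_smul] at htu
    linarith
  refine ⟨‖z₀‖, norm_pos_iff.2 fun h => ?_, IsGreatest.csSup_eq ⟨⟨z₀, le_rfl, ?_⟩, ?_⟩⟩
  · have : u ≤ ψ d ν z₀ := hz₀
    rw [h, hψ0] at this
    linarith
  · exact le_antisymm (hle _ le_rfl) hz₀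
  · rintro _ ⟨z, hz, rfl⟩
    exact hle z hz

lemma ψinv_mem_Ioc (hψ : Continuous (ψ d ν)) {u : ℝ} (hu : 0 < u)
    {ξ : EuclideanSpace ℝ (Fin d)} (hξ : u < ψ d ν ξ) :
    ψinv d ν u ∈ Set.Ioc 0 ‖ξ‖ := by
  obtain ⟨r, hr, hru⟩ := exists_ψstar_eq hψ hu ⟨ξ, hξ.le⟩
  have hub : ‖ξ‖ ∈ upperBounds {r : ℝ | 0 ≤ r ∧ ψstar d ν r = u} := by
    rintro t ⟨-, ht⟩
    by_contra! hlt
    linarith [ψ_le_ψstar hψ hlt.le]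
  have hmem : r ∈ {r : ℝ | 0 ≤ r ∧ ψstar d ν r = u} := ⟨hr.le, hru⟩
  exact ⟨hr.trans_le (le_csSup ⟨_, hub⟩ hmem), csSup_le ⟨r, hmem⟩ hub⟩

variable [NeZero d]

lemma aestronglyMeasurable_comp_norm
    (hint : Integrable (fun z : EuclideanSpace ℝ (Fin d) => min (‖z‖ ^ 2) 1 * ν ‖z‖)) :
    AEStronglyMeasurable (fun z : EuclideanSpace ℝ (Fin d) => ν ‖z‖) := by
  have hm : AEStronglyMeasurable
      (fun z : EuclideanSpace ℝ (Fin d) => (min (‖z‖ ^ 2) 1)⁻¹ * (min (‖z‖ ^ 2) 1 * ν ‖z‖)) :=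
    Measurable.aestronglyMeasurable (by fun_prop) |>.mul hint.aestronglyMeasurable
  refine hm.congr ?_
  filter_upwards [compl_mem_ae_iff.2 (measure_singleton (0 : EuclideanSpace ℝ (Fin d)))] with z hz
  have hz' : 0 < ‖z‖ := norm_pos_iff.2 hz
  have : 0 < min (‖z‖ ^ 2) 1 := lt_min (by positivity) one_pos
  field_simp

/-- A weight that vanishes quadratically at the origin is integrable against the Lévy density. -/
lemma integrable_weight_mul
    (hint : Integrable (fun z : EuclideanSpace ℝ (Fin d) => min (‖z‖ ^ 2) 1 * ν ‖z‖))
    {w : EuclideanSpace ℝ (Fin d) → ℝ} (hw : Measurable w) (C : ℝ)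
    (hwC : ∀ z, |w z| ≤ C * min (‖z‖ ^ 2) 1) :
    Integrable (fun z => w z * ν ‖z‖) := by
  refine (hint.const_mul C).mono
    (hw.aestronglyMeasurable.mul (aestronglyMeasurable_comp_norm hint)) (ae_of_all _ fun z => ?_)
  have h0 : 0 ≤ min (‖z‖ ^ 2) 1 := le_min (by positivity) zero_le_one
  rw [norm_mul, ← mul_assoc, norm_mul]
  exact mul_le_mul_of_nonneg_right ((hwC z).trans (le_abs_self _)) (norm_nonneg _)

lemma integrable_hfun
    (hint : Integrable (fun z : EuclideanSpace ℝ (Fin d) => min (‖z‖ ^ 2) 1 * ν ‖z‖))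
    {r : ℝ} (hr : 0 < r) :
    Integrable (fun z : EuclideanSpace ℝ (Fin d) => min (‖z‖ ^ 2 / r ^ 2) 1 * ν ‖z‖) := by
  refine integrable_weight_mul hint (by fun_prop) (1 + 1 / r ^ 2) fun z => ?_
  rw [abs_of_nonneg (min_sq_div_nonneg r _)]
  exact min_sq_div_le hr _

lemma integrableOn_tail
    (hint : Integrable (fun z : EuclideanSpace ℝ (Fin d) => min (‖z‖ ^ 2) 1 * ν ‖z‖))
    {r : ℝ} (hr : 0 < r) :
    IntegrableOn (fun z : EuclideanSpace ℝ (Fin d) => ν ‖z‖) {z | r ≤ ‖z‖} := by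
  have hs : MeasurableSet {z : EuclideanSpace ℝ (Fin d) | r ≤ ‖z‖} :=
    measurableSet_le measurable_const measurable_norm
  refine ((integrable_hfun hint hr).integrableOn (s := {z | r ≤ ‖z‖})).congr_fun
    (fun z (hz : r ≤ ‖z‖) => ?_) hs
  have : 1 ≤ ‖z‖ ^ 2 / r ^ 2 := by
    rw [one_le_div (by positivity)]; gcongr
  simp [min_eq_right this]

lemma tail_le_hfun (hν_pos : ∀ r : ℝ, 0 < r → 0 < ν r)
    (hint : Integrable (fun z : EuclideanSpace ℝ (Fin d) => min (‖z‖ ^ 2) 1 * ν ‖z‖))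
    {r : ℝ} (hr : 0 < r) :
    ∫ z in {z : EuclideanSpace ℝ (Fin d) | r ≤ ‖z‖}, ν ‖z‖ ≤ hfun d ν r := by
  have hs : MeasurableSet {z : EuclideanSpace ℝ (Fin d) | r ≤ ‖z‖} :=
    measurableSet_le measurable_const measurable_norm
  have heq : ∫ z in {z : EuclideanSpace ℝ (Fin d) | r ≤ ‖z‖}, ν ‖z‖ =
      ∫ z in {z : EuclideanSpace ℝ (Fin d) | r ≤ ‖z‖}, min (‖z‖ ^ 2 / r ^ 2) 1 * ν ‖z‖ := by
    refine setIntegral_congr_fun hs fun z (hz : r ≤ ‖z‖) => ?_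
    have : 1 ≤ ‖z‖ ^ 2 / r ^ 2 := by
      rw [one_le_div (by positivity)]; gcongr
    simp [min_eq_right this]
  rw [heq]
  exact setIntegral_le_integral (integrable_hfun hint hr)
    (ae_of_all _ fun z => min_sq_div_mul_nonneg hν_pos r (norm_nonneg z))

lemma exists_tail_gt (hν_pos : ∀ r : ℝ, 0 < r → 0 < ν r)
    (hint : Integrable (fun z : EuclideanSpace ℝ (Fin d) => min (‖z‖ ^ 2) 1 * ν ‖z‖))
    (hninf : ¬ Integrable (fun z : EuclideanSpace ℝ (Fin d) => ν ‖z‖)) (B : ℝ) :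
    ∃ r : ℝ, 0 < r ∧ B < ∫ z in {z : EuclideanSpace ℝ (Fin d) | r ≤ ‖z‖}, ν ‖z‖ := by
  by_contra! hB
  have hs (r : ℝ) : MeasurableSet {z : EuclideanSpace ℝ (Fin d) | r ≤ ‖z‖} :=
    measurableSet_le measurable_const measurable_norm
  have hcov : AECover (volume : Measure (EuclideanSpace ℝ (Fin d))) atTop
      (fun n : ℕ => {z : EuclideanSpace ℝ (Fin d) | 1 / ((n : ℝ) + 1) ≤ ‖z‖}) := by
    refine ⟨?_, fun n => hs _⟩
    filter_upwards [compl_mem_ae_iff.2 (measure_singleton (0 : EuclideanSpace ℝ (Fin d)))] with z hz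
    exact tendsto_one_div_add_atTop_nhds_zero_nat.eventually_le_const (norm_pos_iff.2 hz)
  refine hninf (hcov.integrable_of_integral_norm_bounded B
    (fun n => integrableOn_tail hint (by positivity)) (Eventually.of_forall fun n => ?_))
  refine le_of_eq_of_le (setIntegral_congr_fun (hs _) fun z hz => ?_)
    (hB (1 / ((n : ℝ) + 1)) (by positivity))
  have hz' : 1 / ((n : ℝ) + 1) ≤ ‖z‖ := hz
  exact norm_of_nonneg (hν_pos _ (lt_of_lt_of_le (by positivity) hz')).le

lemma hfun_anti (hν_pos : ∀ r : ℝ, 0 < r → 0 < ν r)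
    (hint : Integrable (fun z : EuclideanSpace ℝ (Fin d) => min (‖z‖ ^ 2) 1 * ν ‖z‖))
    {r₁ r₂ : ℝ} (h₁ : 0 < r₁) (h₁₂ : r₁ ≤ r₂) : hfun d ν r₂ ≤ hfun d ν r₁ := by
  refine integral_mono (integrable_hfun hint (h₁.trans_le h₁₂)) (integrable_hfun hint h₁)
    fun z => ?_
  rcases (norm_nonneg z).eq_or_lt with hz | hz
  · simp [← hz]
  · have := (hν_pos _ hz).le
    dsimp only
    gcongr

lemma mul_volume_le_tail (hν_mono : ∀ r₁ r₂ : ℝ, 0 < r₁ → r₁ ≤ r₂ → ν r₂ ≤ ν r₁)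
    (hν_pos : ∀ r : ℝ, 0 < r → 0 < ν r)
    (hint : Integrable (fun z : EuclideanSpace ℝ (Fin d) => min (‖z‖ ^ 2) 1 * ν ‖z‖))
    {r : ℝ} (hr : 0 < r) :
    r ^ d * volume.real (Metric.ball (0 : EuclideanSpace ℝ (Fin d)) 1) * ν (3 * r) ≤
      ∫ z in {z : EuclideanSpace ℝ (Fin d) | r ≤ ‖z‖}, ν ‖z‖ := by
  obtain ⟨v, hv⟩ := exists_norm_eq (EuclideanSpace ℝ (Fin d)) (show 0 ≤ 2 * r by positivity)
  have hball : ∀ z ∈ Metric.ball v r, r ≤ ‖z‖ ∧ ‖z‖ ≤ 3 * r := by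
    intro z hz
    rw [mem_ball_iff_norm] at hz
    have h1 := abs_norm_sub_norm_le z v
    rw [abs_le, hv] at h1
    constructor <;> linarith
  have hsub : Metric.ball v r ⊆ {z : EuclideanSpace ℝ (Fin d) | r ≤ ‖z‖} :=
    fun z hz => (hball z hz).1
  have hvol : volume.real (Metric.ball v r) =
      r ^ d * volume.real (Metric.ball (0 : EuclideanSpace ℝ (Fin d)) 1) := by
    rw [measureReal_def, Measure.addHaar_ball volume v hr.le, ENNReal.toReal_mul,
      ENNReal.toReal_ofReal (by positivity), finrank_euclideanSpace_fin, measureReal_def]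
  calc _ = ∫ z in Metric.ball v r, ν (3 * r) := by
        rw [setIntegral_const, hvol, smul_eq_mul]
    _ ≤ ∫ z in Metric.ball v r, ν ‖z‖ := by
        refine setIntegral_mono_on (integrableOn_const (by finiteness))
          ((integrableOn_tail hint hr).mono_set hsub) measurableSet_ball fun z hz => ?_
        exact hν_mono _ _ (hr.trans_le (hball z hz).1) (hball z hz).2
    _ ≤ _ := by
        refine setIntegral_mono_set (integrableOn_tail hint hr) ?_ hsub.eventuallyLE
        refine (ae_restrict_iff' (measurableSet_le measurable_const measurable_norm)).2
          (ae_of_all _ fun z (hz : r ≤ ‖z‖) => (hν_pos _ (hr.trans_le hz)).le)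

lemma hfun_pos (hν_mono : ∀ r₁ r₂ : ℝ, 0 < r₁ → r₁ ≤ r₂ → ν r₂ ≤ ν r₁)
    (hν_pos : ∀ r : ℝ, 0 < r → 0 < ν r)
    (hint : Integrable (fun z : EuclideanSpace ℝ (Fin d) => min (‖z‖ ^ 2) 1 * ν ‖z‖))
    {r : ℝ} (hr : 0 < r) : 0 < hfun d ν r := by
  refine lt_of_lt_of_le ?_
    ((mul_volume_le_tail hν_mono hν_pos hint hr).trans (tail_le_hfun hν_pos hint hr))
  have h1 := hν_pos (3 * r) (by positivity)
  have h2 : 0 < volume.real (Metric.ball (0 : EuclideanSpace ℝ (Fin d)) 1) :=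
    ENNReal.toReal_pos (Metric.measure_ball_pos _ _ one_pos).ne' (by finiteness)
  positivity

lemma integrable_ψ
    (hint : Integrable (fun z : EuclideanSpace ℝ (Fin d) => min (‖z‖ ^ 2) 1 * ν ‖z‖))
    (ξ : EuclideanSpace ℝ (Fin d)) :
    Integrable (fun z : EuclideanSpace ℝ (Fin d) => (1 - cos ⟪ξ, z⟫) * ν ‖z‖) :=
  integrable_weight_mul hint (by fun_prop) _ (abs_one_sub_cos_inner_le ξ)

lemma continuous_ψ (hν_pos : ∀ r : ℝ, 0 < r → 0 < ν r)
    (hint : Integrable (fun z : EuclideanSpace ℝ (Fin d) => min (‖z‖ ^ 2) 1 * ν ‖z‖)) :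
    Continuous (ψ d ν) := by
  refine continuous_iff_continuousAt.2 fun ξ₀ => ?_
  refine continuousAt_of_dominated
    (bound := fun z => (2 + (‖ξ₀‖ + 1) ^ 2) * (min (‖z‖ ^ 2) 1 * ν ‖z‖))
    (Eventually.of_forall fun ξ => (integrable_ψ hint ξ).aestronglyMeasurable) ?_
    (hint.const_mul _) (ae_of_all _ fun z => by fun_prop)
  filter_upwards [Metric.ball_mem_nhds ξ₀ one_pos] with ξ hξ
  refine ae_of_all _ fun z => ?_
  have hξ' : ‖ξ‖ ≤ ‖ξ₀‖ + 1 := by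
    rw [mem_ball_iff_norm] at hξ
    linarith [norm_sub_norm_le ξ ξ₀]
  rcases (norm_nonneg z).eq_or_lt with hz | hz
  · have : z = 0 := norm_eq_zero.1 hz.symm
    simp [this]
  · rw [norm_mul, norm_of_nonneg (hν_pos _ hz).le, ← mul_assoc]
    refine mul_le_mul_of_nonneg_right ((abs_one_sub_cos_inner_le ξ z).trans ?_) (hν_pos _ hz).le
    have h0 : 0 ≤ min (‖z‖ ^ 2) 1 := le_min (by positivity) zero_le_one
    gcongr

/-- By the Riemann–Lebesgue lemma the exponent of an infinite Lévy measure is unbounded. -/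
lemma exists_lt_ψ (hν_pos : ∀ r : ℝ, 0 < r → 0 < ν r)
    (hint : Integrable (fun z : EuclideanSpace ℝ (Fin d) => min (‖z‖ ^ 2) 1 * ν ‖z‖))
    (hninf : ¬ Integrable (fun z : EuclideanSpace ℝ (Fin d) => ν ‖z‖)) (B : ℝ) :
    ∃ ξ : EuclideanSpace ℝ (Fin d), B < ψ d ν ξ := by
  obtain ⟨r, hr, hB⟩ := exists_tail_gt hν_pos hint hninf (B + 1)
  set S : Set (EuclideanSpace ℝ (Fin d)) := {z | r ≤ ‖z‖} with hS_def
  have hS : MeasurableSet S := measurableSet_le measurable_const measurable_norm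
  have hI : IntegrableOn (fun z : EuclideanSpace ℝ (Fin d) => ν ‖z‖) S := integrableOn_tail hint hr
  have hRL := tendsto_integral_exp_inner_smul_cocompact
    (S.indicator fun z : EuclideanSpace ℝ (Fin d) => (ν ‖z‖ : ℂ))
  have hev := hRL.eventually (Metric.ball_mem_nhds (0 : ℂ) one_pos)
  obtain ⟨w, hw⟩ := hev.exists
  rw [dist_zero_right] at hw
  refine ⟨(2 * π) • w, ?_⟩
  have hcosI : IntegrableOn
      (fun z : EuclideanSpace ℝ (Fin d) => cos ⟪(2 * π) • w, z⟫ * ν ‖z‖) S := by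
    refine Integrable.mono hI (Measurable.aestronglyMeasurable (by fun_prop) |>.mul hI.1)
      (ae_of_all _ fun z => ?_)
    rw [norm_mul]
    exact mul_le_of_le_one_left (norm_nonneg _) (abs_cos_le_one _)
  have hcos : ∫ z in S, cos ⟪(2 * π) • w, z⟫ * ν ‖z‖ =
      (∫ v, Real.fourierChar (-⟪v, w⟫) • S.indicator (fun z => (ν ‖z‖ : ℂ)) v).re := by
    have hind : (fun v => Real.fourierChar (-⟪v, w⟫) • S.indicator (fun z => (ν ‖z‖ : ℂ)) v) =
        S.indicator fun v => Real.fourierChar (-⟪v, w⟫) • (ν ‖v‖ : ℂ) := by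
      ext v
      by_cases hv : v ∈ S <;> simp [hv]
    have hchI : IntegrableOn (fun v : EuclideanSpace ℝ (Fin d) =>
        Real.fourierChar (-⟪v, w⟫) • (ν ‖v‖ : ℂ)) S := by
      have := (Real.fourierIntegral_convergent_iff (μ := volume.restrict S)
        (f := fun v : EuclideanSpace ℝ (Fin d) => (ν ‖v‖ : ℂ)) w).2 hI.ofReal
      exact this
    rw [hind, integral_indicator hS]
    refine Eq.trans ?_ (integral_re hchI)
    congr 1
    ext z
    simp [Circle.smul_def, Real.fourierChar_apply, Complex.exp_re, inner_smul_left,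
      real_inner_comm]
  have hre := Complex.abs_re_le_norm
    (∫ v, Real.fourierChar (-⟪v, w⟫) • S.indicator (fun z => (ν ‖z‖ : ℂ)) v)
  rw [← hcos, abs_le] at hre
  calc B < ∫ z in S, ν ‖z‖ - cos ⟪(2 * π) • w, z⟫ * ν ‖z‖ := by
        rw [integral_sub hI hcosI]
        linarith
    _ = ∫ z in S, (1 - cos ⟪(2 * π) • w, z⟫) * ν ‖z‖ := by
        congr 1; ext z; ring
    _ ≤ _ := by
        refine setIntegral_le_integral (integrable_ψ hint _) (ae_of_all _ fun z => ?_)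
        rcases (norm_nonneg z).eq_or_lt with hz | hz
        · have : z = 0 := norm_eq_zero.1 hz.symm
          simp [this]
        · exact mul_nonneg (by linarith [cos_le_one ⟪(2 * π) • w, z⟫]) (hν_pos _ hz).le

/-- The part of `hfun` coming from jumps of size at least `ρ` dominates at large scales. -/
lemma eventually_hfun_le_two_mul (hν_pos : ∀ r : ℝ, 0 < r → 0 < ν r)
    (hν_mono : ∀ r₁ r₂ : ℝ, 0 < r₁ → r₁ ≤ r₂ → ν r₂ ≤ ν r₁)
    (hint : Integrable (fun z : EuclideanSpace ℝ (Fin d) => min (‖z‖ ^ 2) 1 * ν ‖z‖))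
    {β M : ℝ} (hβ : β < 2) (hM : 1 < M)
    (hA1 : ∀ r₁ r₂ : ℝ, 0 < r₁ → r₁ < r₂ → ν r₁ ≤ M * (r₂ / r₁) ^ ((d : ℝ) + β) * ν r₂)
    (ρ : ℝ) :
    ∀ᶠ L : ℝ in atTop, hfun d ν L ≤ 2 * ∫ z in {z : EuclideanSpace ℝ (Fin d) | ρ ≤ ‖z‖},
      min (‖z‖ ^ 2 / L ^ 2) 1 * ν ‖z‖ := by
  set S : Set (EuclideanSpace ℝ (Fin d)) := {z | ρ ≤ ‖z‖} with hS_def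
  have hS : MeasurableSet S := measurableSet_le measurable_const measurable_norm
  set V := volume.real (Metric.ball (0 : EuclideanSpace ℝ (Fin d)) 1) with hV_def
  have hV : 0 < V := ENNReal.toReal_pos (Metric.measure_ball_pos _ _ one_pos).ne' (by finiteness)
  set ρ' := max ρ 1
  have hρ' : 0 < ρ' := lt_max_of_lt_right one_pos
  set C := ρ' ^ 2 * hfun d ν ρ' with hC_def
  set κ := V * ν 1 / (M * 3 ^ ((d : ℝ) + β)) with hκ_def
  have hν1 := hν_pos 1 one_pos
  have hM0 : 0 < M := by linarith
  have hκ : 0 < κ := by positivity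
  have hgrow := (tendsto_rpow_atTop (show 0 < 2 - β by linarith)).eventually_ge_atTop (C / κ)
  filter_upwards [hgrow, eventually_ge_atTop ρ'] with L hL hLρ
  have hL0 : 0 < L := hρ'.trans_le hLρ
  have hL1 : 1 ≤ L := (le_max_right _ _).trans hLρ
  have hinner : ∫ z in Sᶜ, min (‖z‖ ^ 2 / L ^ 2) 1 * ν ‖z‖ ≤ C / L ^ 2 := by
    have : C / L ^ 2 = ∫ z : EuclideanSpace ℝ (Fin d),
        ρ' ^ 2 / L ^ 2 * (min (‖z‖ ^ 2 / ρ' ^ 2) 1 * ν ‖z‖) := by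
      rw [integral_const_mul, hC_def, hfun]; ring
    rw [this]
    have hnn (z : EuclideanSpace ℝ (Fin d)) :
        0 ≤ ρ' ^ 2 / L ^ 2 * (min (‖z‖ ^ 2 / ρ' ^ 2) 1 * ν ‖z‖) :=
      mul_nonneg (by positivity) (min_sq_div_mul_nonneg hν_pos _ (norm_nonneg z))
    have hI := (integrable_hfun hint hρ').const_mul (ρ' ^ 2 / L ^ 2)
    refine (setIntegral_mono_on (integrable_hfun hint hL0).integrableOn hI.integrableOn hS.compl
      fun z hz => ?_).trans (setIntegral_le_integral hI (ae_of_all _ hnn))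
    have hz : ‖z‖ ≤ ρ' := (not_le.1 (show ¬ρ ≤ ‖z‖ from hz)).le.trans (le_max_left _ _)
    rcases (norm_nonneg z).eq_or_lt with h0 | h0
    · simp [← h0]
    · rw [← mul_assoc]
      refine mul_le_mul_of_nonneg_right ?_ (hν_pos _ h0).le
      have : ‖z‖ ^ 2 / ρ' ^ 2 ≤ 1 := by
        rw [div_le_one (by positivity)]; gcongr
      rw [min_eq_left this]
      refine (min_le_left _ _).trans (le_of_eq ?_)
      field_simp
  have houter : C / L ^ 2 ≤ ∫ z in S, min (‖z‖ ^ 2 / L ^ 2) 1 * ν ‖z‖ := by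
    have hν3 : ν 1 / (M * (3 * L) ^ ((d : ℝ) + β)) ≤ ν (3 * L) := by
      have := hA1 1 (3 * L) one_pos (by linarith)
      rw [div_one] at this
      rw [div_le_iff₀ (by positivity)]
      linarith
    have hT : MeasurableSet {z : EuclideanSpace ℝ (Fin d) | L ≤ ‖z‖} :=
      measurableSet_le measurable_const measurable_norm
    have hpow : L ^ d * V * (ν 1 / (M * (3 * L) ^ ((d : ℝ) + β))) = κ * L ^ (2 - β) / L ^ 2 := by
      rw [hκ_def, mul_rpow (by norm_num) hL0.le, rpow_add hL0, rpow_sub hL0, rpow_natCast,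
        rpow_two]
      field_simp
    calc C / L ^ 2 ≤ κ * L ^ (2 - β) / L ^ 2 := by
          gcongr
          rwa [div_le_iff₀' hκ] at hL
      _ = L ^ d * V * (ν 1 / (M * (3 * L) ^ ((d : ℝ) + β))) := hpow.symm
      _ ≤ L ^ d * V * ν (3 * L) := by gcongr
      _ ≤ ∫ z in {z : EuclideanSpace ℝ (Fin d) | L ≤ ‖z‖}, ν ‖z‖ :=
          mul_volume_le_tail hν_mono hν_pos hint hL0
      _ = ∫ z in {z : EuclideanSpace ℝ (Fin d) | L ≤ ‖z‖}, min (‖z‖ ^ 2 / L ^ 2) 1 * ν ‖z‖ := by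
          refine setIntegral_congr_fun hT fun z (hz : L ≤ ‖z‖) => ?_
          have : 1 ≤ ‖z‖ ^ 2 / L ^ 2 := by
            rw [one_le_div (by positivity)]; gcongr
          simp [min_eq_right this]
      _ ≤ _ := by
          refine setIntegral_mono_set (integrable_hfun hint hL0).integrableOn
            (ae_of_all _ fun z => min_sq_div_mul_nonneg hν_pos _ (norm_nonneg z))
            (LE.le.eventuallyLE fun z (hz : L ≤ ‖z‖) => ?_)
          exact (le_max_left _ _).trans (hLρ.trans hz)
  rw [hfun, ← integral_add_compl hS (integrable_hfun hint hL0)]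
  linarith

lemma exists_forall_mul_hfun_le_of_large (hν_pos : ∀ r : ℝ, 0 < r → 0 < ν r)
    (hν_mono : ∀ r₁ r₂ : ℝ, 0 < r₁ → r₁ ≤ r₂ → ν r₂ ≤ ν r₁)
    (hint : Integrable (fun z : EuclideanSpace ℝ (Fin d) => min (‖z‖ ^ 2) 1 * ν ‖z‖))
    {β M : ℝ} (hβ : β < 2) (hM : 1 < M)
    (hA1 : ∀ r₁ r₂ : ℝ, 0 < r₁ → r₁ < r₂ → ν r₁ ≤ M * (r₂ / r₁) ^ ((d : ℝ) + β) * ν r₂)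
    {α : ℝ} (hα : 0 < α)
    (hA2 : ∀ lam : ℝ, 0 < lam →
      Tendsto (fun r : ℝ => ν (lam * r) / ν r) atTop (nhds (lam ^ (-(d : ℝ) - α))))
    (N : ℝ) :
    ∃ ε : ℝ, 0 < ε ∧ ∀ᶠ L : ℝ in atTop, N * hfun d ν L ≤ hfun d ν (ε * L) := by
  obtain ⟨k, hk, hk0⟩ := ((tendsto_rpow_atTop hα).eventually_ge_atTop (4 * N)).and
    (eventually_gt_atTop 0) |>.exists
  set ε := k⁻¹ with hε_def
  have hε : 0 < ε := inv_pos.2 hk0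
  have hεα : 4 * N ≤ ε ^ (-α) := by
    rwa [rpow_neg hε.le, hε_def, inv_rpow hk0.le, inv_inv]
  refine ⟨ε, hε, ?_⟩
  have hq : 0 < ε ^ (-(d : ℝ) - α) := rpow_pos_of_pos hε _
  obtain ⟨ρ₀, hρ₀⟩ := eventually_atTop.1 ((hA2 ε hε).eventually_const_le (half_lt_self hq))
  set ρ := max ρ₀ 1
  have hρ0 : 0 < ρ := lt_max_of_lt_right one_pos
  have hscale (r : ℝ) (hr : ρ ≤ r) : ε ^ (-(d : ℝ) - α) / 2 * ν r ≤ ν (ε * r) := by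
    have := hρ₀ r ((le_max_left _ _).trans hr)
    rwa [le_div_iff₀ (hν_pos r (hρ0.trans_le hr))] at this
  filter_upwards [eventually_hfun_le_two_mul hν_pos hν_mono hint hβ hM hA1 ρ,
    eventually_gt_atTop 0] with L hL hL0
  have hS : MeasurableSet {z : EuclideanSpace ℝ (Fin d) | ρ ≤ ‖z‖} :=
    measurableSet_le measurable_const measurable_norm
  have hεL : 0 < ε * L := mul_pos hε hL0
  have hfe (z : EuclideanSpace ℝ (Fin d)) :
      min (‖ε • z‖ ^ 2 / (ε * L) ^ 2) 1 * ν ‖ε • z‖ =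
        min (‖z‖ ^ 2 / L ^ 2) 1 * ν (ε * ‖z‖) := by
    rw [norm_smul, norm_of_nonneg hε.le, mul_pow, mul_pow,
      mul_div_mul_left _ _ (by positivity : ε ^ 2 ≠ 0)]
  have hcv : hfun d ν (ε * L) =
      ε ^ d * ∫ z : EuclideanSpace ℝ (Fin d), min (‖z‖ ^ 2 / L ^ 2) 1 * ν (ε * ‖z‖) := by
    have := Measure.integral_comp_smul (volume : Measure (EuclideanSpace ℝ (Fin d)))
      (fun z => min (‖z‖ ^ 2 / (ε * L) ^ 2) 1 * ν ‖z‖) ε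
    simp only [hfe] at this
    rw [this, finrank_euclideanSpace_fin, abs_of_pos (by positivity), hfun, smul_eq_mul,
      mul_inv_cancel_left₀ (by positivity)]
  have hcI : Integrable
      (fun z : EuclideanSpace ℝ (Fin d) => min (‖z‖ ^ 2 / L ^ 2) 1 * ν (ε * ‖z‖)) := by
    have := (integrable_hfun hint hεL).comp_smul hε.ne'
    simpa only [hfe] using this
  have hcnn (z : EuclideanSpace ℝ (Fin d)) : 0 ≤ min (‖z‖ ^ 2 / L ^ 2) 1 * ν (ε * ‖z‖) := by
    rw [← hfe]
    exact min_sq_div_mul_nonneg hν_pos _ (norm_nonneg _)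
  set G := ∫ z in {z : EuclideanSpace ℝ (Fin d) | ρ ≤ ‖z‖},
      min (‖z‖ ^ 2 / L ^ 2) 1 * ν ‖z‖ with hG_def
  have hGle : ε ^ (-(d : ℝ) - α) / 2 * G ≤
      ∫ z : EuclideanSpace ℝ (Fin d), min (‖z‖ ^ 2 / L ^ 2) 1 * ν (ε * ‖z‖) := by
    rw [hG_def, ← integral_const_mul]
    refine (setIntegral_mono_on ((integrable_hfun hint hL0).const_mul _).integrableOn
      hcI.integrableOn hS fun z hz => ?_).trans (setIntegral_le_integral hcI (ae_of_all _ hcnn))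
    have := mul_le_mul_of_nonneg_left (hscale _ hz) (min_sq_div_nonneg L ‖z‖)
    linarith
  have hexp : ε ^ d * (ε ^ (-(d : ℝ) - α) / 2) = ε ^ (-α) / 2 := by
    rw [← rpow_natCast, ← mul_div_assoc, ← rpow_add hε]
    congr 2; ring
  have hhpos := hfun_pos hν_mono hν_pos hint hL0
  calc N * hfun d ν L ≤ ε ^ (-α) / 4 * hfun d ν L := by gcongr; linarith
    _ ≤ ε ^ (-α) / 4 * (2 * G) := by gcongr
    _ = ε ^ d * (ε ^ (-(d : ℝ) - α) / 2 * G) := by linear_combination -G * hexp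
    _ ≤ _ := by rw [hcv]; gcongr

lemma exists_forall_mul_hfun_le (hν_pos : ∀ r : ℝ, 0 < r → 0 < ν r)
    (hν_mono : ∀ r₁ r₂ : ℝ, 0 < r₁ → r₁ ≤ r₂ → ν r₂ ≤ ν r₁)
    (hint : Integrable (fun z : EuclideanSpace ℝ (Fin d) => min (‖z‖ ^ 2) 1 * ν ‖z‖))
    (hninf : ¬ Integrable (fun z : EuclideanSpace ℝ (Fin d) => ν ‖z‖))
    {β M : ℝ} (hβ : β < 2) (hM : 1 < M)
    (hA1 : ∀ r₁ r₂ : ℝ, 0 < r₁ → r₁ < r₂ → ν r₁ ≤ M * (r₂ / r₁) ^ ((d : ℝ) + β) * ν r₂)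
    {α : ℝ} (hα : 0 < α)
    (hA2 : ∀ lam : ℝ, 0 < lam →
      Tendsto (fun r : ℝ => ν (lam * r) / ν r) atTop (nhds (lam ^ (-(d : ℝ) - α))))
    {L₁ : ℝ} (hL₁ : 0 < L₁) (N : ℝ) :
    ∃ ε : ℝ, 0 < ε ∧ ε ≤ 1 ∧ ∀ L : ℝ, L₁ ≤ L → N * hfun d ν L ≤ hfun d ν (ε * L) := by
  obtain ⟨ε₁, hε₁, hlarge⟩ :=
    exists_forall_mul_hfun_le_of_large hν_pos hν_mono hint hβ hM hA1 hα hA2 N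
  obtain ⟨L₀, hL₀⟩ := eventually_atTop.1 hlarge
  set L₂ := max L₀ L₁
  have hL₂ : 0 < L₂ := lt_max_of_lt_right hL₁
  obtain ⟨η, hη, hηB⟩ := exists_tail_gt hν_pos hint hninf (|N| * hfun d ν L₁)
  refine ⟨min (min ε₁ 1) (η / L₂), by positivity, (min_le_left _ _).trans (min_le_right _ _),
    fun L hL => ?_⟩
  have hL0 : 0 < L := hL₁.trans_le hL
  rcases le_total L₂ L with h | h
  · refine (hL₀ L ((le_max_left _ _).trans h)).trans (hfun_anti hν_pos hint (by positivity) ?_)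
    gcongr
    exact (min_le_left _ _).trans (min_le_left _ _)
  · have hhpos := hfun_pos hν_mono hν_pos hint hL0
    calc N * hfun d ν L ≤ |N| * hfun d ν L₁ := by
          gcongr
          · exact le_abs_self N
          · exact hfun_anti hν_pos hint hL₁ hL
      _ ≤ hfun d ν η := hηB.le.trans (tail_le_hfun hν_pos hint hη)
      _ ≤ _ := hfun_anti hν_pos hint (by positivity) ?_
    calc _ ≤ η / L₂ * L₂ := by
          gcongr
          exact min_le_right _ _
      _ = η := by field_simp

end Auxiliary

theorem statement18
    (d : ℕ) (hd : 1 ≤ d) (ν : ℝ → ℝ)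
    (hν_pos : ∀ r : ℝ, 0 < r → 0 < ν r)
    (hν_mono : ∀ r₁ r₂ : ℝ, 0 < r₁ → r₁ ≤ r₂ → ν r₂ ≤ ν r₁)
    (hint : Integrable (fun z : EuclideanSpace ℝ (Fin d) => min (‖z‖ ^ 2) 1 * ν ‖z‖))
    (hninf : ¬ Integrable (fun z : EuclideanSpace ℝ (Fin d) => ν ‖z‖))
    (β M : ℝ) (hβ : β ∈ Set.Ioo (0:ℝ) 2) (hM : 1 < M)
    (hA1 : ∀ r₁ r₂ : ℝ, 0 < r₁ → r₁ < r₂ → ν r₁ ≤ M * (r₂ / r₁) ^ ((d:ℝ) + β) * ν r₂)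
    (α : ℝ) (hα : α ∈ Set.Ioo (0:ℝ) 2)
    (hA2 : ∀ lam : ℝ, 0 < lam →
      Tendsto (fun r : ℝ => ν (lam * r) / ν r) atTop (nhds (lam ^ (-(d:ℝ) - α))))
    (hnorm : ∀ ξ : EuclideanSpace ℝ (Fin d), ‖ξ‖ = 1 → ψ d ν ξ = 1)
:
    ∀ R : ℝ, 0 < R → ∀ N : ℝ, ∃ δ : ℝ, 0 < δ ∧ δ < R ∧
      ∀ s : ℝ, 1 ≤ s →
        N ≤ hfun d ν (2 * δ / ψinv d ν (1 / s)) /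
              hfun d ν (R / (2 * ψinv d ν (1 / s))) := by
  intro R hR N
  have : NeZero d := ⟨by omega⟩
  have hψ := continuous_ψ hν_pos hint
  obtain ⟨ξ, hξ⟩ := exists_lt_ψ hν_pos hint hninf 1
  have hξ0 : 0 < ‖ξ‖ :=
    (ψinv_mem_Ioc hψ one_pos hξ).1.trans_le (ψinv_mem_Ioc hψ one_pos hξ).2
  obtain ⟨ε, hε0, hε1, hε⟩ := exists_forall_mul_hfun_le hν_pos hν_mono hint hninf hβ.2 hM hA1
    hα.1 hA2 (show 0 < R / (2 * ‖ξ‖) by positivity) N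
  refine ⟨ε * R / 4, by positivity, by nlinarith, fun s hs => ?_⟩
  have hs0 : 0 < s := one_pos.trans_le hs
  obtain ⟨hx0, hx⟩ := ψinv_mem_Ioc hψ (one_div_pos.2 hs0)
    (((div_le_one hs0).2 hs).trans_lt hξ)
  rw [le_div_iff₀ (hfun_pos hν_mono hν_pos hint (by positivity))]
  have h := hε (R / (2 * ψinv d ν (1 / s))) (by gcongr)
  rwa [show ε * (R / (2 * ψinv d ν (1 / s))) = 2 * (ε * R / 4) / ψinv d ν (1 / s) by
    field_simp; ring] at h

end
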